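/- arXiv:0909.3949 — 5 statements merged into one kernel-verified Lean document; each statement's English description precedes it below -/
import Mathlib

section
/- Let h₅ : ℝ → ℝ be positive, and let s(v) = √(h₅(v)) be differentiable with s'(v) > 0 for all v; let h₀ > 0 be a constant and define h₄(v) = (h₀·s'(v))². Then for all v: √(h₄(v)·h₅(v)) = (h₀/2)·h₅'(v); consequently the function v ↦ √(h₄(v)h₅(v))/h₅'(v) is constant and, whenever s' is differentiable, ∂_v log( √(h₄h₅)/∂_vh₅ ) = 0, i.e. the pair (h₄,h₅) satisfies the v-equation (4ep2a) with vanishing source Υ₂ = 0. -/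
/-- The derivative of a nonnegative function in terms of its square root. -/
theorem deriv_eq_two_mul_sqrt_mul_deriv_sqrt {f : ℝ → ℝ} (hf : ∀ t, 0 ≤ f t) {v : ℝ}
    (hs : DifferentiableAt ℝ (fun t => Real.sqrt (f t)) v) :
    deriv f v = 2 * Real.sqrt (f v) * deriv (fun t => Real.sqrt (f t)) v := by
  have h := hs.hasDerivAt.fun_pow 2
  simp only [Real.sq_sqrt (hf _)] at h
  simpa using h.deriv

/-- Formula (p1): for prescribed h₅, the coefficient h₄ = (h₀·∂_v√h₅)² solves the
sourceless vertical Einstein equation (4ep2a). -/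
theorem stmt_4 (h₅ : ℝ → ℝ) (h5pos : ∀ v, 0 < h₅ v)
    (hs : ∀ v, DifferentiableAt ℝ (fun t => Real.sqrt (h₅ t)) v)
    (hs' : ∀ v, 0 < deriv (fun t => Real.sqrt (h₅ t)) v)
    (h₀ : ℝ) (hh₀ : 0 < h₀)
    (h₄ : ℝ → ℝ)
    (h4def : ∀ v, h₄ v = (h₀ * deriv (fun t => Real.sqrt (h₅ t)) v) ^ 2) :
    (∀ v, Real.sqrt (h₄ v * h₅ v) = (h₀ / 2) * deriv h₅ v) ∧
    (∀ v w, Real.sqrt (h₄ v * h₅ v) / deriv h₅ v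
      = Real.sqrt (h₄ w * h₅ w) / deriv h₅ w) ∧
    (∀ v, DifferentiableAt ℝ (deriv (fun t => Real.sqrt (h₅ t))) v →
      deriv (fun t =>
        Real.log (Real.sqrt (h₄ t * h₅ t) / deriv h₅ t)) v = 0) := by
  have hderiv : ∀ v, deriv h₅ v
      = 2 * Real.sqrt (h₅ v) * deriv (fun t => Real.sqrt (h₅ t)) v := fun v =>
    deriv_eq_two_mul_sqrt_mul_deriv_sqrt (fun t => (h5pos t).le) (hs v)
  have hsqrt : ∀ v, Real.sqrt (h₄ v * h₅ v) = (h₀ / 2) * deriv h₅ v := fun v => by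
    rw [h4def, Real.sqrt_mul (sq_nonneg _), Real.sqrt_sq (mul_pos hh₀ (hs' v)).le, hderiv]
    ring
  have hratio : ∀ v, Real.sqrt (h₄ v * h₅ v) / deriv h₅ v = h₀ / 2 := fun v => by
    have hpos : 0 < deriv h₅ v := by
      rw [hderiv]
      exact mul_pos (mul_pos two_pos (Real.sqrt_pos.2 (h5pos v))) (hs' v)
    rw [hsqrt, mul_div_cancel_right₀ _ hpos.ne']
  refine ⟨hsqrt, fun v w => by rw [hratio, hratio], fun v _ => ?_⟩
  simp only [hratio, deriv_const]
end

section
/- Let h₄ : ℝ → ℝ be continuous and positive, let a, b, v₀ ∈ ℝ with b ≠ 0, define s(v) = a + b·∫_{v₀}^{v} √(h₄(t)) dt and assume s(v) > 0 for all v. Set h₅(v) = s(v)². Then h₅ is differentiable and for all v: √(h₄(v)·h₅(v)) = h₅'(v)/(2b); consequently the function v ↦ √(h₄(v)h₅(v))/h₅'(v) is constant, so the pair (h₄,h₅) satisfies the v-equation (4ep2a) with vanishing source Υ₂ = 0 wherever the logarithmic derivative ∂_v log(√(h₄h₅)/∂_vh₅) is defined. -/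
/-- Formula (p2): for prescribed h₄, the coefficient √h₅ = a + b∫√h₄ dv solves the
sourceless vertical Einstein equation (4ep2a). -/
theorem stmt_5 (h₄ : ℝ → ℝ) (hcont : Continuous h₄) (h4pos : ∀ v, 0 < h₄ v)
    (a b v₀ : ℝ) (hb : b ≠ 0)
    (s : ℝ → ℝ) (hs : ∀ v, s v = a + b * ∫ t in v₀..v, Real.sqrt (h₄ t))
    (hspos : ∀ v, 0 < s v)
    (h₅ : ℝ → ℝ) (h5def : ∀ v, h₅ v = (s v) ^ 2) :
    Differentiable ℝ h₅ ∧
    (∀ v, Real.sqrt (h₄ v * h₅ v) = deriv h₅ v / (2 * b)) ∧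
    (∀ v w, Real.sqrt (h₄ v * h₅ v) / deriv h₅ v
      = Real.sqrt (h₄ w * h₅ w) / deriv h₅ w) ∧
    (∀ v, deriv (fun t =>
        Real.log (Real.sqrt (h₄ t * h₅ t) / deriv h₅ t)) v = 0) := by
  have hsqrt : Continuous fun t => Real.sqrt (h₄ t) := hcont.sqrt
  have hsderiv : ∀ v, HasDerivAt s (b * Real.sqrt (h₄ v)) v := by
    intro v
    rw [funext hs]
    exact ((hsqrt.integral_hasStrictDerivAt v₀ v).hasDerivAt.const_mul b).const_add a
  have h5deriv : ∀ v, HasDerivAt h₅ (2 * s v * (b * Real.sqrt (h₄ v))) v := by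
    intro v
    rw [funext h5def]
    simpa using (hsderiv v).fun_pow 2
  have hroot : ∀ v, Real.sqrt (h₄ v * h₅ v) = Real.sqrt (h₄ v) * s v := by
    intro v
    rw [h5def, Real.sqrt_mul (h4pos v).le, Real.sqrt_sq (hspos v).le]
  have hratio : ∀ v, Real.sqrt (h₄ v * h₅ v) / deriv h₅ v = 1 / (2 * b) := by
    intro v
    have hs0 := (hspos v).ne'
    have h40 := (Real.sqrt_pos.2 (h4pos v)).ne'
    rw [hroot, (h5deriv v).deriv]
    field_simp
  refine ⟨fun v => (h5deriv v).differentiableAt, fun v => ?_, fun v w => ?_, fun v => ?_⟩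
  · rw [hroot, (h5deriv v).deriv]
    field_simp
  · rw [hratio, hratio]
  · simp only [hratio, deriv_const]
end

section
/- Let f : ℝ → ℝ be twice differentiable with f'(v) > 0 for all v, let f₀ ∈ ℝ satisfy f(v) > f₀ for all v, and let h₀ > 0 be a constant. Define h₄(v) = h₀·(f'(v))² and h₅(v) = (f(v) − f₀)². Then for all v the generating function φ(v) = log( h₅'(v)/√(h₄(v)·h₅(v)) ) is constant, equal to log(2/√h₀); hence φ'(v)·h₅'(v) = 0 for all v, i.e. (h₄,h₅) satisfies the v-equation (4ep2a) with vanishing source Υ₂ = 0. -/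
/-- Vacuum case of the generating formulas (coeff) of the Main Theorem:
h₄ = h₀(∂_v f)², h₅ = (f − f₀)² make the generating function φ constant,
whence (4ep2a) holds with vanishing source. -/
theorem stmt_6 (f : ℝ → ℝ)
    (hdf : Differentiable ℝ f) (hdf' : Differentiable ℝ (deriv f))
    (hf' : ∀ v, 0 < deriv f v)
    (f₀ : ℝ) (hff₀ : ∀ v, f₀ < f v)
    (h₀ : ℝ) (hh₀ : 0 < h₀)
    (h₄ h₅ : ℝ → ℝ)
    (h4def : ∀ v, h₄ v = h₀ * (deriv f v) ^ 2)
    (h5def : ∀ v, h₅ v = (f v - f₀) ^ 2) :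
    (∀ v, Real.log (deriv h₅ v / Real.sqrt (h₄ v * h₅ v))
        = Real.log (2 / Real.sqrt h₀)) ∧
    (∀ v, deriv (fun t => Real.log (deriv h₅ t / Real.sqrt (h₄ t * h₅ t))) v
        * deriv h₅ v = 0) := by
  have hφ : ∀ v, Real.log (deriv h₅ v / Real.sqrt (h₄ v * h₅ v))
      = Real.log (2 / Real.sqrt h₀) := by
    intro v
    have hd : deriv h₅ v = 2 * (f v - f₀) * deriv f v := by
      rw [funext h5def]
      simpa using (((hdf v).hasDerivAt.sub_const f₀).fun_pow 2).deriv
    have hf : 0 < f v - f₀ := sub_pos.2 (hff₀ v)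
    have hv := hf' v
    have hsqrt : Real.sqrt (h₄ v * h₅ v) = Real.sqrt h₀ * (deriv f v * (f v - f₀)) := by
      rw [h4def, h5def, mul_assoc, ← mul_pow, Real.sqrt_mul hh₀.le,
        Real.sqrt_sq (mul_pos hv hf).le]
    have hs : 0 < Real.sqrt h₀ := Real.sqrt_pos.2 hh₀
    rw [hd, hsqrt]
    congr 1
    field_simp
  refine ⟨hφ, fun v => ?_⟩
  rw [funext hφ, deriv_const, zero_mul]
end

section
/- Let f : ℝ → ℝ be twice differentiable with f'(v) > 0 for all v, f₀ ∈ ℝ with f(v) > f₀ for all v, h₀ > 0, Υ : ℝ → ℝ continuous, c ∈ ℝ, v₀ ∈ ℝ, and define q(v) = c + 2h₀·∫_{v₀}^{v} Υ(t)·f'(t)·(f(t) − f₀) dt; assume q(v) > 0 for all v. Define h₄(v) = h₀·(f'(v))²/q(v) and h₅(v) = (f(v) − f₀)². Then h₄, h₅ are positive with h₅'(v) > 0, and for all v, with φ(v) = log( h₅'(v)/√(h₄(v)·h₅(v)) ): φ'(v)·h₅'(v) = 2·Υ(v)·h₄(v)·h₅(v). That is, (h₄,h₅) solves the v-equation (4ep2a)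 with anisotropic source Υ₂ = Υ. -/
/-- Sourced generating formula of the Main Theorem (formulas (coeff), (aux2f)–(aux3f)):
h₅ = (f−f₀)², h₄ = h₀(∂_v f)²/q with q obtained by integrating Υ·∂_v f·(f−f₀),
solves the vertical equation (4ep2a) with anisotropic source Υ. -/
theorem stmt_7 (f : ℝ → ℝ)
    (hdf : Differentiable ℝ f) (hdf' : Differentiable ℝ (deriv f))
    (hf' : ∀ v, 0 < deriv f v)
    (f₀ : ℝ) (hff₀ : ∀ v, f₀ < f v)
    (h₀ : ℝ) (hh₀ : 0 < h₀)
    (Υ : ℝ → ℝ) (hΥ : Continuous Υ) (c v₀ : ℝ)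
    (q : ℝ → ℝ)
    (hq : ∀ v, q v = c + 2 * h₀ * ∫ t in v₀..v, Υ t * deriv f t * (f t - f₀))
    (hqpos : ∀ v, 0 < q v)
    (h₄ h₅ : ℝ → ℝ)
    (h4def : ∀ v, h₄ v = h₀ * (deriv f v) ^ 2 / q v)
    (h5def : ∀ v, h₅ v = (f v - f₀) ^ 2) :
    (∀ v, 0 < h₄ v) ∧ (∀ v, 0 < h₅ v) ∧ (∀ v, 0 < deriv h₅ v) ∧
    (∀ v, deriv (fun t => Real.log (deriv h₅ t / Real.sqrt (h₄ t * h₅ t))) v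
        * deriv h₅ v = 2 * Υ v * h₄ v * h₅ v) := by
  have hpos : ∀ v, 0 < f v - f₀ := fun v => sub_pos.mpr (hff₀ v)
  have hh5 : h₅ = fun v => (f v - f₀) ^ 2 := funext h5def
  have hd5 : ∀ v, deriv h₅ v = 2 * (f v - f₀) * deriv f v := fun v => by
    rw [hh5]
    simpa using (((hdf v).hasDerivAt.sub_const f₀).fun_pow 2).deriv
  refine ⟨fun v => ?_, fun v => ?_, fun v => ?_, fun v => ?_⟩
  · rw [h4def]
    exact div_pos (mul_pos hh₀ (pow_pos (hf' v) 2)) (hqpos v)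
  · rw [h5def]
    exact pow_pos (hpos v) 2
  · rw [hd5]
    exact mul_pos (mul_pos two_pos (hpos v)) (hf' v)
  · have hlog : (fun t => Real.log (deriv h₅ t / Real.sqrt (h₄ t * h₅ t))) =
        fun t => Real.log (4 * q t / h₀) / 2 := by
      funext t
      have h1 := hpos t
      have h2 := hf' t
      have h3 := hqpos t
      rw [← Real.log_sqrt (by positivity), hd5, h4def, h5def]
      congr 1
      rw [← Real.sqrt_sq (by positivity : 0 ≤ 2 * (f t - f₀) * deriv f t),
        ← Real.sqrt_div (by positivity)]
      congr 1
      field_simp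
      norm_num
    have hcont : Continuous fun t => Υ t * deriv f t * (f t - f₀) :=
      (hΥ.mul hdf'.continuous).mul (hdf.continuous.sub continuous_const)
    have hqd : HasDerivAt q (2 * h₀ * (Υ v * deriv f v * (f v - f₀))) v := by
      rw [funext hq]
      exact ((hcont.integral_hasStrictDerivAt v₀ v).hasDerivAt.const_mul (2 * h₀)).const_add c
    have hq0 := hqpos v
    have hφ := ((((hqd.const_mul 4).div_const h₀).log (by positivity)).div_const 2).deriv
    rw [hlog, hφ, hd5, h4def, h5def]
    field_simp
end

section
/- Let h₄, h₅ : ℝ × ℝ → ℝ, written h₄(x,v), h₅(x,v), be positive with ∂_vh₅ > 0 everywhere, and assume all partial derivatives appearing below exist (in particular ∂_vh₄, ∂²_vh₅, ∂_xh₄, ∂_xh₅, ∂_x(∂_vh₅), and the partial derivatives of φ). Define φ(x,v) = log( ∂_vh₅/√(h₄h₅) ) and assume ∂_vφ(x,v) ≠ 0 at every point. Define w(x,v) = ∂_xφ(x,v)/∂_vφ(x,v). Then at every point: w·[ ∂²_vh₅ − (∂_vh₅)²/(2h₅) − ∂_vh₄·∂_vh₅/(2h₄) ] + (∂_vh₅/2)·(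 ∂_xh₄/h₄ + ∂_xh₅/h₅ ) − ∂_x(∂_vh₅) = 0. -/
/-- Partial derivative in the first (horizontal) variable. -/
noncomputable def pdx (f : ℝ → ℝ → ℝ) (x v : ℝ) : ℝ := deriv (fun t => f t v) x

/-- Partial derivative in the second (anisotropic) variable v. -/
noncomputable def pdv (f : ℝ → ℝ → ℝ) (x v : ℝ) : ℝ := deriv (fun t => f x t) v

/-- The generating function φ = log(∂_v h₅/√(h₄h₅)) of (auxphi). -/
noncomputable def phiGen (h₄ h₅ : ℝ → ℝ → ℝ) (x v : ℝ) : ℝ :=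
  Real.log (pdv h₅ x v / Real.sqrt (h₄ x v * h₅ x v))

/-- Logarithmic derivative of `p / √(a b)` for positive functions of one variable. -/
theorem hasDerivAt_log_div_sqrt_mul {a b p : ℝ → ℝ} {a' b' p' t : ℝ}
    (ha : HasDerivAt a a' t) (hb : HasDerivAt b b' t) (hp : HasDerivAt p p' t)
    (ha0 : ∀ s, 0 < a s) (hb0 : ∀ s, 0 < b s) (hp0 : ∀ s, 0 < p s) :
    HasDerivAt (fun s => Real.log (p s / Real.sqrt (a s * b s)))
      (p' / p t - (a' / a t + b' / b t) / 2) t := by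
  have hlog : (fun s => Real.log (p s / Real.sqrt (a s * b s))) =
      fun s => Real.log (p s) - (Real.log (a s) + Real.log (b s)) / 2 := by
    funext s
    have hab := mul_pos (ha0 s) (hb0 s)
    rw [Real.log_div (hp0 s).ne' (Real.sqrt_pos.2 hab).ne', Real.log_sqrt hab.le,
      Real.log_mul (ha0 s).ne' (hb0 s).ne']
  rw [hlog]
  exact (hp.log (hp0 t).ne').sub (((ha.log (ha0 t).ne').add (hb.log (hb0 t).ne')).div_const 2)

/-- The coefficients w = ∂_xφ/∂_vφ of formula (w1) solve equation (4ep3a),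
2h₅·R̂₄ₓ = 0, whenever ∂_vφ ≠ 0. -/
theorem stmt_9 (h₄ h₅ : ℝ → ℝ → ℝ)
    (h4pos : ∀ x v, 0 < h₄ x v) (h5pos : ∀ x v, 0 < h₅ x v)
    (h5vpos : ∀ x v, 0 < pdv h₅ x v)
    (hv4 : ∀ x v, DifferentiableAt ℝ (fun t => h₄ x t) v)
    (hvv5 : ∀ x v, DifferentiableAt ℝ (fun t => pdv h₅ x t) v)
    (hx4 : ∀ x v, DifferentiableAt ℝ (fun t => h₄ t v) x)
    (hx5 : ∀ x v, DifferentiableAt ℝ (fun t => h₅ t v) x)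
    (hxv5 : ∀ x v, DifferentiableAt ℝ (fun t => pdv h₅ t v) x)
    (hφx : ∀ x v, DifferentiableAt ℝ (fun t => phiGen h₄ h₅ t v) x)
    (hφv : ∀ x v, DifferentiableAt ℝ (fun t => phiGen h₄ h₅ x t) v)
    (hφvne : ∀ x v, pdv (phiGen h₄ h₅) x v ≠ 0)
    (w : ℝ → ℝ → ℝ)
    (hw : ∀ x v, w x v = pdx (phiGen h₄ h₅) x v / pdv (phiGen h₄ h₅) x v) :
    ∀ x v,
      w x v * (pdv (pdv h₅) x v - (pdv h₅ x v) ^ 2 / (2 * h₅ x v)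
          - pdv h₄ x v * pdv h₅ x v / (2 * h₄ x v))
        + (pdv h₅ x v / 2) * (pdx h₄ x v / h₄ x v + pdx h₅ x v / h₅ x v)
        - pdx (pdv h₅) x v = 0 := by
  intro x v
  have hv5 : DifferentiableAt ℝ (fun t => h₅ x t) v :=
    differentiableAt_of_deriv_ne_zero (h5vpos x v).ne'
  have hpx : pdx (phiGen h₄ h₅) x v = pdx (pdv h₅) x v / pdv h₅ x v -
      (pdx h₄ x v / h₄ x v + pdx h₅ x v / h₅ x v) / 2 :=
    (hasDerivAt_log_div_sqrt_mul (hx4 x v).hasDerivAt (hx5 x v).hasDerivAt (hxv5 x v).hasDerivAt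
      (fun s => h4pos s v) (fun s => h5pos s v) (fun s => h5vpos s v)).deriv
  have hpv : pdv (phiGen h₄ h₅) x v = pdv (pdv h₅) x v / pdv h₅ x v -
      (pdv h₄ x v / h₄ x v + pdv h₅ x v / h₅ x v) / 2 :=
    (hasDerivAt_log_div_sqrt_mul (hv4 x v).hasDerivAt hv5.hasDerivAt (hvv5 x v).hasDerivAt
      (h4pos x) (h5pos x) (h5vpos x)).deriv
  have h4 := (h4pos x v).ne'
  have h5 := (h5pos x v).ne'
  have hp := (h5vpos x v).ne'
  have hbracket : pdv (pdv h₅) x v - (pdv h₅ x v) ^ 2 / (2 * h₅ x v)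
      - pdv h₄ x v * pdv h₅ x v / (2 * h₄ x v) =
      pdv h₅ x v * pdv (phiGen h₄ h₅) x v := by
    rw [hpv]
    field_simp
    ring
  have hw' : w x v * pdv (phiGen h₄ h₅) x v = pdx (phiGen h₄ h₅) x v := by
    rw [hw, div_mul_cancel₀ _ (hφvne x v)]
  rw [hbracket, mul_left_comm, hw', hpx]
  field_simp
  ring
end
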